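/- For c > 0, the operator norm of the convolution operator (Cf)(y) = (1/(2πi)) ∫_ℝ f(x)/(x - y - 2ic) dx on L^2(ℝ, ℂ) is not attained: there is no nonzero f ∈ L^2(ℝ) with ‖Cf‖ = ‖f‖. -/

import Mathlib

open MeasureTheory

open scoped FourierTransform SchwartzMap

/-- The Fourier multiplier `ξ ↦ 𝟙_{ξ > 0} exp (-4 π c ξ)` of the Cauchy kernel at height `2c`. -/
noncomputable def cauchyMultiplier (c : ℝ) : ℝ → ℂ :=
  (Set.Ioi (0 : ℝ)).indicator fun ξ => Complex.exp ((-4 * Real.pi * c : ℝ) * (ξ : ℂ))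

lemma norm_cauchyMultiplier_lt_one {c : ℝ} (hc : 0 < c) (ξ : ℝ) :
    ‖cauchyMultiplier c ξ‖ < 1 := by
  unfold cauchyMultiplier
  by_cases h : ξ ∈ Set.Ioi (0 : ℝ)
  · rw [Set.indicator_of_mem h, ← Complex.ofReal_mul, Complex.norm_exp_ofReal, Real.exp_lt_one_iff]
    have : 0 < Real.pi * c * ξ := mul_pos (mul_pos Real.pi_pos hc) h
    linarith
  · simp [Set.indicator_of_notMem h]

lemma integrable_cauchyMultiplier {c : ℝ} (hc : 0 < c) : Integrable (cauchyMultiplier c) := by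
  refine (integrable_indicator_iff measurableSet_Ioi).2
    (integrableOn_exp_mul_complex_Ioi (a := ((-4 * Real.pi * c : ℝ) : ℂ)) ?_ 0)
  have := mul_pos Real.pi_pos hc
  rw [Complex.ofReal_re]
  linarith

lemma memLp_top_cauchyMultiplier {c : ℝ} (hc : 0 < c) :
    MemLp (cauchyMultiplier c) ⊤ (volume : Measure ℝ) :=
  memLp_top_of_bound (integrable_cauchyMultiplier hc).1 1
    (.of_forall fun ξ => (norm_cauchyMultiplier_lt_one hc ξ).le)

/-- The modulated multiplier has the Cauchy kernel as its Fourier transform. -/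
lemma fourier_modulated_cauchyMultiplier {c : ℝ} (hc : 0 < c) (x y : ℝ) :
    𝓕 (fun ξ : ℝ => Real.fourierChar (ξ * y) • cauchyMultiplier c ξ) x =
      (1 / (2 * Real.pi * Complex.I)) * (1 / ((x : ℂ) - y - 2 * c * Complex.I)) := by
  set a : ℂ := -(2 * Real.pi * Complex.I) * ((x : ℂ) - y - 2 * c * Complex.I) with ha
  have hre : a.re < 0 := by
    have := mul_pos Real.pi_pos hc
    simp [ha]
    linarith
  have hint : ∀ ξ : ℝ, Real.fourierChar (-(ξ * x)) •
      (Real.fourierChar (ξ * y) • cauchyMultiplier c ξ) =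
      (Set.Ioi (0 : ℝ)).indicator (fun ξ : ℝ => Complex.exp (a * ξ)) ξ := by
    intro ξ
    unfold cauchyMultiplier
    by_cases h : ξ ∈ Set.Ioi (0 : ℝ)
    · rw [Set.indicator_of_mem h, Set.indicator_of_mem h]
      simp only [Circle.smul_def, Real.fourierChar_apply, smul_eq_mul, ← Complex.exp_add]
      congr 1
      push_cast [ha]
      linear_combination (-4 * Real.pi * c * ξ : ℂ) * Complex.I_sq
    · simp [Set.indicator_of_notMem h]
  rw [Real.fourier_real_eq]
  simp_rw [hint]
  rw [integral_indicator measurableSet_Ioi, integral_exp_mul_complex_Ioi hre]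
  simp only [ha, Complex.ofReal_zero, mul_zero, Complex.exp_zero, one_div]
  rw [neg_mul, neg_div_neg_eq, one_div, mul_inv]

/-- On integrable functions the Cauchy integral is a Fourier multiplier. -/
lemma cauchyIntegral_eq_fourierInv {c : ℝ} (hc : 0 < c) {f : ℝ → ℂ} (hf : Integrable f) (y : ℝ) :
    (1 / (2 * Real.pi * Complex.I)) * ∫ x : ℝ, f x / ((x : ℂ) - y - 2 * c * Complex.I) =
      𝓕⁻ (fun ξ => cauchyMultiplier c ξ * 𝓕 f ξ) y := by
  have hm : Integrable (fun ξ : ℝ => Real.fourierChar (ξ * y) • cauchyMultiplier c ξ) := by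
    have := (Real.fourierIntegral_convergent_iff (μ := volume) (-y)).2
      (integrable_cauchyMultiplier hc)
    simpa [mul_comm] using this
  have key := VectorFourier.integral_fourierIntegral_smul_eq_flip (e := Real.fourierChar)
    (μ := volume) (ν := volume) (L := innerₗ ℝ) Real.continuous_fourierChar
    continuous_inner hf hm
  have hflip : (innerₗ ℝ).flip = innerₗ ℝ := flip_innerₗ ℝ
  rw [hflip] at key
  change ∫ ξ, 𝓕 f ξ • (Real.fourierChar (ξ * y) • cauchyMultiplier c ξ) =
    ∫ x, f x • 𝓕 (fun ξ : ℝ => Real.fourierChar (ξ * y) • cauchyMultiplier c ξ) x at key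
  simp_rw [fourier_modulated_cauchyMultiplier hc] at key
  rw [← integral_const_mul, Real.fourierInv_eq]
  calc _ = _ := integral_congr_ae (.of_forall fun x => by simp only [smul_eq_mul]; ring)
    _ = _ := key.symm
    _ = _ := integral_congr_ae (.of_forall fun ξ => by
      simp [Circle.smul_def, mul_comm, mul_left_comm, mul_assoc])

/-- Multiplication by `cauchyMultiplier c` on `L²`. -/
noncomputable def cauchyMultiplierL {c : ℝ} (hc : 0 < c) :
    Lp ℂ 2 (volume : Measure ℝ) →L[ℂ] Lp ℂ 2 (volume : Measure ℝ) :=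
  (ContinuousLinearMap.mul ℂ ℂ).holderL volume ⊤ 2 2 (memLp_top_cauchyMultiplier hc).toLp

lemma coeFn_cauchyMultiplierL {c : ℝ} (hc : 0 < c) (f : Lp ℂ 2 (volume : Measure ℝ)) :
    cauchyMultiplierL hc f =ᵐ[volume] fun ξ => cauchyMultiplier c ξ * f ξ := by
  filter_upwards [(ContinuousLinearMap.mul ℂ ℂ).coeFn_holder (r := 2)
    (memLp_top_cauchyMultiplier hc).toLp f, (memLp_top_cauchyMultiplier hc).coeFn_toLp] with ξ h h'
  rw [← h']
  exact h

lemma eq_zero_of_norm_le_norm_cauchyMultiplierL {c : ℝ} (hc : 0 < c)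
    {f : Lp ℂ 2 (volume : Measure ℝ)} (h : ‖f‖ ≤ ‖cauchyMultiplierL hc f‖) : f = 0 := by
  have norm_sq (g : Lp ℂ 2 (volume : Measure ℝ)) : ‖g‖ ^ 2 = ∫ x, ‖g x‖ ^ 2 := by
    have := L2.inner_def (𝕜 := ℂ) g g
    simp only [inner_self_eq_norm_sq_to_K] at this
    exact_mod_cast this
  have hint (g : Lp ℂ 2 (volume : Measure ℝ)) : Integrable fun x => ‖g x‖ ^ 2 :=
    (memLp_two_iff_integrable_sq_norm (Lp.memLp g).1).1 (Lp.memLp g)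
  have hM := coeFn_cauchyMultiplierL hc f
  have hpt : ∀ᵐ x, ‖cauchyMultiplierL hc f x‖ ^ 2 = ‖cauchyMultiplier c x‖ ^ 2 * ‖f x‖ ^ 2 := by
    filter_upwards [hM] with x hx
    rw [hx, norm_mul, mul_pow]
  have hlt (x : ℝ) : ‖cauchyMultiplier c x‖ ^ 2 < 1 :=
    pow_lt_one₀ (norm_nonneg _) (norm_cauchyMultiplier_lt_one hc x) two_ne_zero
  have hnonneg : 0 ≤ᵐ[volume] fun x => ‖f x‖ ^ 2 - ‖cauchyMultiplierL hc f x‖ ^ 2 := by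
    filter_upwards [hpt] with x hx
    have := mul_le_mul_of_nonneg_right (hlt x).le (sq_nonneg ‖f x‖)
    simp only [Pi.zero_apply, hx]
    linarith
  have hzero : ∫ x, (‖f x‖ ^ 2 - ‖cauchyMultiplierL hc f x‖ ^ 2) = 0 := by
    refine le_antisymm ?_ (integral_nonneg_of_ae hnonneg)
    rw [integral_sub (hint f) (hint _), ← norm_sq, ← norm_sq]
    exact sub_nonpos.2 (pow_le_pow_left₀ (norm_nonneg _) h 2)
  rw [integral_eq_zero_iff_of_nonneg_ae hnonneg ((hint f).sub (hint _))] at hzero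
  refine (Lp.eq_zero_iff_ae_eq_zero).2 ?_
  filter_upwards [hzero, hpt] with x hx hx'
  simp only [Pi.zero_apply, hx'] at hx ⊢
  have : (1 - ‖cauchyMultiplier c x‖ ^ 2) * ‖f x‖ ^ 2 = 0 := by linarith
  simpa [(sub_pos.2 (hlt x)).ne'] using this

/-- The Fourier multiplier identity, tested against `L²` functions. -/
lemma inner_cauchyOperator_eq {c : ℝ} (hc : 0 < c)
    (C : Lp ℂ 2 (volume : Measure ℝ) →L[ℂ] Lp ℂ 2 (volume : Measure ℝ))
    (hC : ∀ f : Lp ℂ 2 (volume : Measure ℝ), ∀ᵐ y : ℝ,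
      (C f : ℝ → ℂ) y =
        (1 / (2 * Real.pi * Complex.I)) *
          ∫ x : ℝ, (f : ℝ → ℂ) x / ((x : ℂ) - y - 2 * c * Complex.I))
    (h f : Lp ℂ 2 (volume : Measure ℝ)) :
    inner ℂ h (C f) = inner ℂ (𝓕 h) (cauchyMultiplierL hc (𝓕 f)) := by
  have hdense : DenseRange (SchwartzMap.toLpCLM ℝ ℂ 2 (volume : Measure ℝ)) :=
    SchwartzMap.denseRange_toLpCLM ENNReal.ofNat_ne_top
  have hF : Continuous fun f : Lp ℂ 2 (volume : Measure ℝ) => 𝓕 f :=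
    (Lp.fourierTransformₗᵢ ℝ ℂ).continuous
  refine hdense.induction_on₂ (p := fun h f : Lp ℂ 2 (volume : Measure ℝ) =>
    inner ℂ h (C f) = inner ℂ (𝓕 h) (cauchyMultiplierL hc (𝓕 f))) ?_ ?_ h f
  · exact isClosed_eq (by fun_prop) (by fun_prop)
  intro h f
  simp only [SchwartzMap.toLpCLM_apply, SchwartzMap.toLp_fourier_eq]
  have hg : Integrable fun ξ => cauchyMultiplier c ξ * 𝓕 (f : ℝ → ℂ) ξ := by
    rw [← SchwartzMap.fourier_coe]
    exact (𝓕 f).integrable.bdd_mul (integrable_cauchyMultiplier hc).1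
      (.of_forall fun ξ => (norm_cauchyMultiplier_lt_one hc ξ).le)
  have key := VectorFourier.integral_sesq_fourierIntegral_eq_neg_flip (e := Real.fourierChar)
    (μ := volume) (ν := volume) (L := innerₗ ℝ) (innerSL ℂ) Real.continuous_fourierChar
    continuous_inner h.integrable hg
  have hflip : (innerₗ ℝ).flip = innerₗ ℝ := flip_innerₗ ℝ
  rw [hflip] at key
  change ∫ ξ, inner ℂ (𝓕 (h : ℝ → ℂ) ξ) (cauchyMultiplier c ξ * 𝓕 (f : ℝ → ℂ) ξ) =
    ∫ x, inner ℂ (h x) (𝓕⁻ (fun ξ => cauchyMultiplier c ξ * 𝓕 (f : ℝ → ℂ) ξ) x) at key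
  rw [L2.inner_def, L2.inner_def]
  refine Eq.trans (integral_congr_ae ?_) (key.symm.trans (integral_congr_ae ?_))
  · filter_upwards [hC (f.toLp 2), h.coeFn_toLp 2] with y hy hh
    rw [hy, hh, ← cauchyIntegral_eq_fourierInv hc f.integrable]
    congr 2
    refine integral_congr_ae ?_
    filter_upwards [f.coeFn_toLp 2] with x hx
    rw [hx]
  · filter_upwards [coeFn_cauchyMultiplierL hc ((𝓕 f).toLp 2), (𝓕 f).coeFn_toLp 2,
      (𝓕 h).coeFn_toLp 2] with ξ h₁ h₂ h₃
    rw [h₁, h₂, h₃, SchwartzMap.fourier_coe, SchwartzMap.fourier_coe]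

theorem stmt_5 (c : ℝ) (hc : 0 < c)
    (C : Lp ℂ 2 (volume : Measure ℝ) →L[ℂ] Lp ℂ 2 (volume : Measure ℝ))
    (hC : ∀ f : Lp ℂ 2 (volume : Measure ℝ), ∀ᵐ y : ℝ,
      (C f : ℝ → ℂ) y =
        (1 / (2 * Real.pi * Complex.I)) *
          ∫ x : ℝ, (f : ℝ → ℂ) x / ((x : ℂ) - y - 2 * c * Complex.I)) :
    ¬ ∃ f : Lp ℂ 2 (volume : Measure ℝ), f ≠ 0 ∧ ‖C f‖ = ‖f‖ := by
  rintro ⟨f, hf0, hf⟩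
  have hpos : 0 < ‖C f‖ := hf ▸ norm_pos_iff.2 hf0
  have hle : ‖C f‖ * ‖C f‖ ≤ ‖C f‖ * ‖cauchyMultiplierL hc (𝓕 f)‖ := by
    rw [← inner_self_eq_norm_mul_norm (𝕜 := ℂ), inner_cauchyOperator_eq hc C hC]
    simpa using re_inner_le_norm (𝕜 := ℂ) (𝓕 (C f)) (cauchyMultiplierL hc (𝓕 f))
  have hzero : 𝓕 f = 0 := by
    refine eq_zero_of_norm_le_norm_cauchyMultiplierL hc ?_
    rw [Lp.norm_fourier_eq, ← hf]
    exact le_of_mul_le_mul_left hle hpos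
  refine hf0 (norm_eq_zero.1 ?_)
  rw [← Lp.norm_fourier_eq, hzero, norm_zero]
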